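/- Let M, a be reals with 0 ≤ a < M, u₀ a real constant, C > 0, and g̃ : (0, π) → ℝ a C² function of θ with g̃(θ)² > C² for all θ ∈ (0,π). On U, the 2-form F₇ = (u₀/(C sinθ)) dθ ∧ [ √(g̃² − C²) (dt − a sin²θ dφ) + g̃ (ρ²/Δ) dr ] is closed and force-free (F₇_{μν} j^ν = 0 for its current density j), and F₇² := g^{μα}g^{νβ}F₇_{αβ}F₇_{μν} = 2u₀²/(Δ sin²θ), so F₇ is magnetically dominated when u₀ ≠ 0. -/

import Mathlib

noncomputable section

/-- Partial derivative of `f` in the coordinate direction `μ`,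
coordinates `(x 0, x 1, x 2, x 3) = (t, r, θ, φ)`. -/
def pd (μ : Fin 4) (f : (Fin 4 → ℝ) → ℝ) (x : Fin 4 → ℝ) : ℝ :=
  fderiv ℝ f x (Pi.single μ 1)

/-- ρ² = r² + a² cos²θ. -/
def rho2 (a : ℝ) (x : Fin 4 → ℝ) : ℝ := (x 1) ^ 2 + a ^ 2 * Real.cos (x 2) ^ 2

/-- Δ = r² − 2Mr + a². -/
def Del (M a : ℝ) (x : Fin 4 → ℝ) : ℝ := (x 1) ^ 2 - 2 * M * (x 1) + a ^ 2

/-- Σ² = (r²+a²)² − Δ a² sin²θ. -/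
def Sig2 (M a : ℝ) (x : Fin 4 → ℝ) : ℝ :=
  ((x 1) ^ 2 + a ^ 2) ^ 2 - Del M a x * a ^ 2 * Real.sin (x 2) ^ 2

/-- The Kerr metric in Boyer–Lindquist coordinates `(t, r, θ, φ)`. -/
def kerr (M a : ℝ) (x : Fin 4 → ℝ) : Matrix (Fin 4) (Fin 4) ℝ :=
  Matrix.of fun μ ν =>
    if μ = 0 ∧ ν = 0 then -1 + 2 * M * (x 1) / rho2 a x
    else if (μ = 0 ∧ ν = 3) ∨ (μ = 3 ∧ ν = 0) then
      -(2 * M * (x 1) * a * Real.sin (x 2) ^ 2) / rho2 a x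
    else if μ = 1 ∧ ν = 1 then rho2 a x / Del M a x
    else if μ = 2 ∧ ν = 2 then rho2 a x
    else if μ = 3 ∧ ν = 3 then Sig2 M a x * Real.sin (x 2) ^ 2 / rho2 a x
    else 0

/-- The exterior Kerr domain U = {r > r₊, 0 < θ < π}. -/
def KerrExt (M a : ℝ) : Set (Fin 4 → ℝ) :=
  {x | M + Real.sqrt (M ^ 2 - a ^ 2) < x 1 ∧ 0 < x 2 ∧ x 2 < Real.pi}

/-- `wedge μ ν f` is the antisymmetric matrix of the 2-form `f dx^μ ∧ dx^ν`. -/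
def wedge (μ ν : Fin 4) (f : ℝ) : Matrix (Fin 4) (Fin 4) ℝ :=
  Matrix.of fun i j => if i = μ ∧ j = ν then f else if i = ν ∧ j = μ then -f else 0

/-- A 2-form `F` is closed on `S`: ∂_μ F_{νλ} + ∂_ν F_{λμ} + ∂_λ F_{μν} = 0. -/
def Closed2Form (F : (Fin 4 → ℝ) → Matrix (Fin 4) (Fin 4) ℝ) (S : Set (Fin 4 → ℝ)) : Prop :=
  ∀ x ∈ S, ∀ μ ν lam : Fin 4,
    pd μ (fun y => F y ν lam) x + pd ν (fun y => F y lam μ) x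
      + pd lam (fun y => F y μ ν) x = 0

/-- Current density j^μ = (ρ²sinθ)⁻¹ ∂_ν (ρ²sinθ g^{μα} g^{νβ} F_{αβ}). -/
def current (M a : ℝ) (F : (Fin 4 → ℝ) → Matrix (Fin 4) (Fin 4) ℝ)
    (x : Fin 4 → ℝ) (μ : Fin 4) : ℝ :=
  (rho2 a x * Real.sin (x 2))⁻¹ *
    ∑ ν : Fin 4, pd ν (fun y => rho2 a y * Real.sin (y 2) *
      ∑ i : Fin 4, ∑ j : Fin 4, (kerr M a y)⁻¹ μ i * (kerr M a y)⁻¹ ν j * F y i j) x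

/-- `F` is force-free on `S`: F_{μν} j^ν = 0 for the current density `j` of `F`. -/
def ForceFree (M a : ℝ) (F : (Fin 4 → ℝ) → Matrix (Fin 4) (Fin 4) ℝ)
    (S : Set (Fin 4 → ℝ)) : Prop :=
  ∀ x ∈ S, ∀ μ : Fin 4, ∑ ν : Fin 4, F x μ ν * current M a F x ν = 0

/-- The invariant F² = g^{μα} g^{νβ} F_{αβ} F_{μν}. -/
def Fsq (M a : ℝ) (F : (Fin 4 → ℝ) → Matrix (Fin 4) (Fin 4) ℝ) (x : Fin 4 → ℝ) : ℝ :=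
  ∑ μ : Fin 4, ∑ ν : Fin 4, ∑ i : Fin 4, ∑ j : Fin 4,
    (kerr M a x)⁻¹ μ i * (kerr M a x)⁻¹ ν j * F x i j * F x μ ν

/-- F₇ = (u₀/(C sinθ)) dθ ∧ [ √(g̃²−C²)(dt − a sin²θ dφ) + g̃ (ρ²/Δ) dr ]. -/
def F7 (M a u₀ C : ℝ) (gtil : ℝ → ℝ) (x : Fin 4 → ℝ) : Matrix (Fin 4) (Fin 4) ℝ :=
  wedge 2 0 (u₀ / (C * Real.sin (x 2)) * Real.sqrt (gtil (x 2) ^ 2 - C ^ 2))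
    + wedge 2 3 (u₀ / (C * Real.sin (x 2)) * Real.sqrt (gtil (x 2) ^ 2 - C ^ 2) *
        (-(a * Real.sin (x 2) ^ 2)))
    + wedge 2 1 (u₀ / (C * Real.sin (x 2)) * (gtil (x 2) * rho2 a x / Del M a x))

theorem aux_pd_const (μ : Fin 4) (f : (Fin 4 → ℝ) → ℝ) (x : Fin 4 → ℝ)
    (h : ∀ t : ℝ, f (x + t • Pi.single μ 1) = f x) : pd μ f x = 0 := by
  unfold pd
  by_cases hd : DifferentiableAt ℝ f x
  · have h1 := hd.hasFDerivAt.hasLineDerivAt (Pi.single μ 1)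
    unfold HasLineDerivAt at h1
    have h2 : (fun t : ℝ => f (x + t • Pi.single μ 1)) = fun _ => f x := funext h
    rw [h2] at h1
    exact h1.unique (hasDerivAt_const _ _)
  · rw [fderiv_zero_of_not_differentiableAt hd]; rfl

theorem aux_pd_neg (μ : Fin 4) (f : (Fin 4 → ℝ) → ℝ) (x : Fin 4 → ℝ) :
    pd μ (fun y => -f y) x = -pd μ f x := by
  unfold pd
  rw [fderiv_fun_neg]; rfl

theorem aux_pd_zero (μ : Fin 4) (x : Fin 4 → ℝ) : pd μ (fun _ => (0 : ℝ)) x = 0 :=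
  aux_pd_const _ _ _ (fun _ => rfl)

theorem aux_pd_two (q p : ℝ → ℝ) (p' : ℝ) (x : Fin 4 → ℝ)
    (hq : DifferentiableAt ℝ q (x 1)) (hp : HasDerivAt p p' (x 2)) :
    pd 2 (fun y => q (y 1) * p (y 2)) x = q (x 1) * p' := by
  have hd : DifferentiableAt ℝ (fun y : Fin 4 → ℝ => q (y 1) * p (y 2)) x := by
    have h1 : DifferentiableAt ℝ (fun y : Fin 4 → ℝ => q (y 1)) x :=
      DifferentiableAt.comp (g := q) x hq (differentiableAt_apply 1 x)
    have h2 : DifferentiableAt ℝ (fun y : Fin 4 → ℝ => p (y 2)) x :=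
      DifferentiableAt.comp (g := p) x hp.differentiableAt (differentiableAt_apply 2 x)
    exact h1.mul h2
  have h1 := hd.hasFDerivAt.hasLineDerivAt (Pi.single 2 1)
  unfold HasLineDerivAt at h1
  unfold pd
  refine h1.unique ?_
  have h3 : HasDerivAt (fun t : ℝ => p (x 2 + t)) p' 0 := by
    have := HasDerivAt.comp_const_add (x 2) 0 (f := p) (f' := p') (by simpa using hp)
    exact this
  have := h3.const_mul (q (x 1))
  simpa using this

theorem aux_pos (M a : ℝ) (ha : 0 ≤ a) (haM : a < M) (x : Fin 4 → ℝ)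
    (hx : x ∈ KerrExt M a) :
    0 < rho2 a x ∧ 0 < Del M a x ∧ 0 < Real.sin (x 2) := by
  obtain ⟨h1, h2, h3⟩ := hx
  have hs : 0 ≤ Real.sqrt (M ^ 2 - a ^ 2) := Real.sqrt_nonneg _
  have hs2 : Real.sqrt (M ^ 2 - a ^ 2) ^ 2 = M ^ 2 - a ^ 2 := Real.sq_sqrt (by nlinarith)
  refine ⟨?_, ?_, Real.sin_pos_of_pos_of_lt_pi h2 h3⟩
  · unfold rho2
    have : 0 < x 1 := by linarith
    positivity
  · unfold Del
    nlinarith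

theorem aux_open (M a : ℝ) : IsOpen (KerrExt M a) := by
  unfold KerrExt
  refine (isOpen_lt continuous_const (continuous_apply 1)).inter
    ((isOpen_lt continuous_const (continuous_apply 2)).inter
      (isOpen_lt (continuous_apply 2) continuous_const))

theorem aux_inv (M a : ℝ) (ha : 0 ≤ a) (haM : a < M) (x : Fin 4 → ℝ)
    (hx : x ∈ KerrExt M a) :
    (kerr M a x)⁻¹ =
      !![-(Sig2 M a x) / (rho2 a x * Del M a x), 0, 0,
          -(2 * M * x 1 * a) / (rho2 a x * Del M a x);
         0, Del M a x / rho2 a x, 0, 0;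
         0, 0, 1 / rho2 a x, 0;
         -(2 * M * x 1 * a) / (rho2 a x * Del M a x), 0, 0,
          (Del M a x - a ^ 2 * Real.sin (x 2) ^ 2) /
            (rho2 a x * Del M a x * Real.sin (x 2) ^ 2)] := by
  obtain ⟨h1, h2, h3⟩ := aux_pos M a ha haM x hx
  have e1 : rho2 a x = x 1 ^ 2 + a ^ 2 - a ^ 2 * Real.sin (x 2) ^ 2 := by
    unfold rho2; rw [Real.cos_sq']; ring
  have n1 := h1.ne'
  have n2 := h2.ne'
  have n3 := h3.ne'
  apply Matrix.inv_eq_right_inv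
  ext i j
  fin_cases i <;> fin_cases j <;>
    simp [kerr, Matrix.mul_apply, Fin.sum_univ_four, n1, n2] <;>
    field_simp <;>
    (try unfold Sig2) <;> (generalize hR : rho2 a x = R at *) <;> (try subst e1) <;>
    (try unfold Del) <;> ring

/-- The components of F7. -/
theorem aux_F (M a u₀ C : ℝ) (gtil : ℝ → ℝ) (x : Fin 4 → ℝ) :
    F7 M a u₀ C gtil x =
      (let K := u₀ / (C * Real.sin (x 2))
       let S := Real.sqrt (gtil (x 2) ^ 2 - C ^ 2)
       let A := K * S
       let D := K * S * (-(a * Real.sin (x 2) ^ 2))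
       let B := K * (gtil (x 2) * rho2 a x / Del M a x)
       !![0, 0, -A, 0; 0, 0, -B, 0; A, B, 0, D; 0, 0, -D, 0]) := by
  ext i j
  fin_cases i <;> fin_cases j <;> simp [F7, wedge]

/-- The components of the densitized field with upper indices. -/
theorem aux_G (M a u₀ C : ℝ) (ha : 0 ≤ a) (haM : a < M) (hC : 0 < C) (gtil : ℝ → ℝ)
    (y : Fin 4 → ℝ) (hy : y ∈ KerrExt M a) (μ ν : Fin 4) :
    rho2 a y * Real.sin (y 2) *
      ∑ i : Fin 4, ∑ j : Fin 4,
        (kerr M a y)⁻¹ μ i * (kerr M a y)⁻¹ ν j * F7 M a u₀ C gtil y i j =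
      (let S := Real.sqrt (gtil (y 2) ^ 2 - C ^ 2)
       let A := -(u₀ / C * ((y 1 ^ 2 + a ^ 2) / (y 1 ^ 2 - 2 * M * y 1 + a ^ 2))) * S
       let D := -(u₀ / C * (a / (y 1 ^ 2 - 2 * M * y 1 + a ^ 2))) * S
       let B := u₀ / C * gtil (y 2)
       (!![0, 0, -A, 0; 0, 0, -B, 0; A, B, 0, D; 0, 0, -D, 0] : Matrix (Fin 4) (Fin 4) ℝ))
        μ ν := by
  obtain ⟨h1, h2, h3⟩ := aux_pos M a ha haM y hy
  have e1 : rho2 a y = y 1 ^ 2 + a ^ 2 - a ^ 2 * Real.sin (y 2) ^ 2 := by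
    unfold rho2; rw [Real.cos_sq']; ring
  have e2 : y 1 ^ 2 - 2 * M * y 1 + a ^ 2 = Del M a y := rfl
  have n1 := h1.ne'
  have n2 := h2.ne'
  have n3 := h3.ne'
  rw [aux_inv M a ha haM y hy, aux_F, e2]
  generalize Real.sqrt (gtil (y 2) ^ 2 - C ^ 2) = S
  generalize gtil (y 2) = G
  fin_cases μ <;> fin_cases ν <;>
    simp [Fin.sum_univ_four] <;>
    field_simp <;>
    (try unfold Sig2) <;> (generalize hR : rho2 a y = R at *) <;> (try subst e1) <;>
    (try unfold Del) <;> ring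

theorem aux_closed (M a u₀ C : ℝ) (gtil : ℝ → ℝ) (S : Set (Fin 4 → ℝ)) :
    Closed2Form (F7 M a u₀ C gtil) S := by
  intro x _ μ ν lam
  simp only [aux_F]
  set A : (Fin 4 → ℝ) → ℝ := fun x =>
    u₀ / (C * Real.sin (x 2)) * Real.sqrt (gtil (x 2) ^ 2 - C ^ 2) with hA
  set D : (Fin 4 → ℝ) → ℝ := fun x =>
    u₀ / (C * Real.sin (x 2)) * Real.sqrt (gtil (x 2) ^ 2 - C ^ 2) *
      (-(a * Real.sin (x 2) ^ 2)) with hD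
  set B : (Fin 4 → ℝ) → ℝ := fun x =>
    u₀ / (C * Real.sin (x 2)) * (gtil (x 2) * rho2 a x / Del M a x) with hB
  have a0 : pd 0 A x = 0 := aux_pd_const _ _ _ (fun t => by simp [hA])
  have a1 : pd 1 A x = 0 := aux_pd_const _ _ _ (fun t => by simp [hA])
  have a3 : pd 3 A x = 0 := aux_pd_const _ _ _ (fun t => by simp [hA])
  have d0 : pd 0 D x = 0 := aux_pd_const _ _ _ (fun t => by simp [hD])
  have d1 : pd 1 D x = 0 := aux_pd_const _ _ _ (fun t => by simp [hD])
  have d3 : pd 3 D x = 0 := aux_pd_const _ _ _ (fun t => by simp [hD])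
  have b0 : pd 0 B x = 0 := aux_pd_const _ _ _ (fun t => by simp [hB, rho2, Del])
  have b3 : pd 3 B x = 0 := aux_pd_const _ _ _ (fun t => by simp [hB, rho2, Del])
  have key : ∀ i j k : Fin 4,
      pd k (fun y => (!![0, 0, -A y, 0; 0, 0, -B y, 0; A y, B y, 0, D y; 0, 0, -D y, 0] :
        Matrix (Fin 4) (Fin 4) ℝ) i j) x =
      (!![0, 0, -pd k A x, 0; 0, 0, -pd k B x, 0; pd k A x, pd k B x, 0, pd k D x;
        0, 0, -pd k D x, 0] : Matrix (Fin 4) (Fin 4) ℝ) i j := by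
    intro i j k
    fin_cases i <;> fin_cases j <;>
      first
      | exact aux_pd_zero k x
      | exact aux_pd_neg k _ x
      | rfl
  change pd μ (fun y => (!![0, 0, -A y, 0; 0, 0, -B y, 0; A y, B y, 0, D y; 0, 0, -D y, 0] :
        Matrix (Fin 4) (Fin 4) ℝ) ν lam) x +
    pd ν (fun y => (!![0, 0, -A y, 0; 0, 0, -B y, 0; A y, B y, 0, D y; 0, 0, -D y, 0] :
        Matrix (Fin 4) (Fin 4) ℝ) lam μ) x +
    pd lam (fun y => (!![0, 0, -A y, 0; 0, 0, -B y, 0; A y, B y, 0, D y; 0, 0, -D y, 0] :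
        Matrix (Fin 4) (Fin 4) ℝ) μ ν) x = 0
  rw [key, key, key]
  clear key
  clear_value A B D
  fin_cases μ <;> fin_cases ν <;> fin_cases lam <;>
    simp [a0, a1, a3, d0, d1, d3, b0, b3]

theorem aux_current (M a u₀ C : ℝ) (ha : 0 ≤ a) (haM : a < M) (hC : 0 < C) (gtil : ℝ → ℝ)
    (x : Fin 4 → ℝ) (hx : x ∈ KerrExt M a) (S' g' : ℝ)
    (hS : HasDerivAt (fun θ => Real.sqrt (gtil θ ^ 2 - C ^ 2)) S' (x 2))
    (hg : HasDerivAt gtil g' (x 2)) (μ : Fin 4) :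
    current M a (F7 M a u₀ C gtil) x μ = (rho2 a x * Real.sin (x 2))⁻¹ *
      (![u₀ / C * ((x 1 ^ 2 + a ^ 2) / Del M a x) * S', -(u₀ / C * g'), 0,
        u₀ / C * (a / Del M a x) * S'] : Fin 4 → ℝ) μ := by
  have n2 : x 1 ^ 2 - 2 * M * x 1 + a ^ 2 ≠ 0 := (aux_pos M a ha haM x hx).2.1.ne'
  unfold current
  congr 1
  set A : (Fin 4 → ℝ) → ℝ := fun y =>
    -(u₀ / C * ((y 1 ^ 2 + a ^ 2) / (y 1 ^ 2 - 2 * M * y 1 + a ^ 2))) *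
      Real.sqrt (gtil (y 2) ^ 2 - C ^ 2) with hA
  set D : (Fin 4 → ℝ) → ℝ := fun y =>
    -(u₀ / C * (a / (y 1 ^ 2 - 2 * M * y 1 + a ^ 2))) *
      Real.sqrt (gtil (y 2) ^ 2 - C ^ 2) with hD
  set B : (Fin 4 → ℝ) → ℝ := fun y => u₀ / C * gtil (y 2) with hB
  have hpd : ∀ ν : Fin 4, pd ν (fun y => rho2 a y * Real.sin (y 2) *
      ∑ i : Fin 4, ∑ j : Fin 4,
        (kerr M a y)⁻¹ μ i * (kerr M a y)⁻¹ ν j * F7 M a u₀ C gtil y i j) x =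
      (!![0, 0, -pd ν A x, 0; 0, 0, -pd ν B x, 0; pd ν A x, pd ν B x, 0, pd ν D x;
        0, 0, -pd ν D x, 0] : Matrix (Fin 4) (Fin 4) ℝ) μ ν := by
    intro ν
    have h : (fun y => rho2 a y * Real.sin (y 2) *
      ∑ i : Fin 4, ∑ j : Fin 4,
        (kerr M a y)⁻¹ μ i * (kerr M a y)⁻¹ ν j * F7 M a u₀ C gtil y i j) =ᶠ[nhds x]
        (fun y => (!![0, 0, -A y, 0; 0, 0, -B y, 0; A y, B y, 0, D y; 0, 0, -D y, 0] :
          Matrix (Fin 4) (Fin 4) ℝ) μ ν) := by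
      filter_upwards [(aux_open M a).mem_nhds hx] with y hy
      exact aux_G M a u₀ C ha haM hC gtil y hy μ ν
    unfold pd
    rw [h.fderiv_eq]
    change pd ν _ x = (!![0, 0, -pd ν A x, 0; 0, 0, -pd ν B x, 0;
      pd ν A x, pd ν B x, 0, pd ν D x; 0, 0, -pd ν D x, 0] : Matrix (Fin 4) (Fin 4) ℝ) μ ν
    generalize hk : pd ν = P
    have p0 : P (fun _ => 0) x = 0 := hk ▸ aux_pd_zero ν x
    have pn : ∀ f, P (fun y => -f y) x = -P f x := fun f => hk ▸ aux_pd_neg ν f x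
    clear_value A B D
    fin_cases μ <;> fin_cases ν <;>
      first
      | exact p0
      | exact pn _
      | rfl
  simp only [hpd]
  have a0 : pd 0 A x = 0 := aux_pd_const _ _ _ (fun t => by simp [hA])
  have d3 : pd 3 D x = 0 := aux_pd_const _ _ _ (fun t => by simp [hD])
  have b1 : pd 1 B x = 0 := aux_pd_const _ _ _ (fun t => by simp [hB])
  have a2 : pd 2 A x = -(u₀ / C * ((x 1 ^ 2 + a ^ 2) / Del M a x)) * S' :=
    aux_pd_two (fun r => -(u₀ / C * ((r ^ 2 + a ^ 2) / (r ^ 2 - 2 * M * r + a ^ 2))))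
      _ S' x (by fun_prop (disch := exact n2)) hS
  have d2 : pd 2 D x = -(u₀ / C * (a / Del M a x)) * S' :=
    aux_pd_two (fun r => -(u₀ / C * (a / (r ^ 2 - 2 * M * r + a ^ 2))))
      _ S' x (by fun_prop (disch := exact n2)) hS
  have b2 : pd 2 B x = u₀ / C * g' :=
    aux_pd_two (fun _ => u₀ / C) _ g' x (by fun_prop) hg
  clear_value A B D
  fin_cases μ <;> simp [Fin.sum_univ_four, a0, a2, b1, b2, d2, d3]

theorem aux_Fsq (M a u₀ C : ℝ) (ha : 0 ≤ a) (haM : a < M) (hC : 0 < C) (gtil : ℝ → ℝ)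
    (x : Fin 4 → ℝ) (hx : x ∈ KerrExt M a) (hgC : C ^ 2 < gtil (x 2) ^ 2) :
    Fsq M a (F7 M a u₀ C gtil) x = 2 * u₀ ^ 2 / (Del M a x * Real.sin (x 2) ^ 2) := by
  obtain ⟨h1, h2, h3⟩ := aux_pos M a ha haM x hx
  have n1 := h1.ne'
  have n2 := h2.ne'
  have n3 := h3.ne'
  have e1 : rho2 a x = x 1 ^ 2 + a ^ 2 - a ^ 2 * Real.sin (x 2) ^ 2 := by
    unfold rho2; rw [Real.cos_sq']; ring
  have e2 : x 1 ^ 2 - 2 * M * x 1 + a ^ 2 = Del M a x := rfl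
  have hs2 : Real.sqrt (gtil (x 2) ^ 2 - C ^ 2) ^ 2 = gtil (x 2) ^ 2 - C ^ 2 :=
    Real.sq_sqrt (by linarith)
  have key : ∀ μ ν : Fin 4, ∑ i : Fin 4, ∑ j : Fin 4,
      (kerr M a x)⁻¹ μ i * (kerr M a x)⁻¹ ν j * F7 M a u₀ C gtil x i j * F7 M a u₀ C gtil x μ ν
      = (rho2 a x * Real.sin (x 2))⁻¹ * (rho2 a x * Real.sin (x 2) * ∑ i : Fin 4, ∑ j : Fin 4,
      (kerr M a x)⁻¹ μ i * (kerr M a x)⁻¹ ν j * F7 M a u₀ C gtil x i j)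
        * F7 M a u₀ C gtil x μ ν := by
    intro μ ν
    simp only [← Finset.sum_mul]
    rw [inv_mul_cancel_left₀ (mul_ne_zero n1 n3)]
  unfold Fsq
  simp only [key, aux_G M a u₀ C ha haM hC gtil x hx]
  simp only [aux_F, e2]
  simp [Fin.sum_univ_four]
  generalize Real.sqrt (gtil (x 2) ^ 2 - C ^ 2) = S at *
  have hG : gtil (x 2) ^ 2 = S ^ 2 + C ^ 2 := by linarith
  generalize gtil (x 2) = G at *
  have e3 : x 1 ^ 2 + a ^ 2 = rho2 a x + a ^ 2 * Real.sin (x 2) ^ 2 := by linarith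
  rw [e3]
  field_simp
  ring_nf
  simp only [hG]
  ring

/-- F₇ is closed and force-free, and F₇² = 2u₀²/(Δ sin²θ), so F₇ is
magnetically dominated when u₀ ≠ 0. -/
theorem kerr_F7_forcefree (M a u₀ C : ℝ) (ha : 0 ≤ a) (haM : a < M) (hC : 0 < C)
    (gtil : ℝ → ℝ) (hg : ContDiffOn ℝ 2 gtil (Set.Ioo 0 Real.pi))
    (hgC : ∀ θ ∈ Set.Ioo 0 Real.pi, C ^ 2 < gtil θ ^ 2) :
    Closed2Form (F7 M a u₀ C gtil) (KerrExt M a) ∧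
    ForceFree M a (F7 M a u₀ C gtil) (KerrExt M a) ∧
    ∀ x ∈ KerrExt M a,
      Fsq M a (F7 M a u₀ C gtil) x = 2 * u₀ ^ 2 / (Del M a x * Real.sin (x 2) ^ 2) ∧
      (u₀ ≠ 0 → 0 < Fsq M a (F7 M a u₀ C gtil) x) := by
  refine ⟨aux_closed M a u₀ C gtil _, ?_, ?_⟩
  · intro x hx μ
    obtain ⟨h1, h2, h3⟩ := aux_pos M a ha haM x hx
    have hθ : x 2 ∈ Set.Ioo 0 Real.pi := hx.2
    have hgd : HasDerivAt gtil (deriv gtil (x 2)) (x 2) :=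
      ((hg.differentiableOn (by norm_num)).differentiableAt
        (isOpen_Ioo.mem_nhds hθ)).hasDerivAt
    have hpos : 0 < gtil (x 2) ^ 2 - C ^ 2 := by linarith [hgC _ hθ]
    have hS := ((hgd.fun_pow 2).sub_const (C ^ 2)).sqrt hpos.ne'
    have hSp : 0 < Real.sqrt (gtil (x 2) ^ 2 - C ^ 2) := Real.sqrt_pos.mpr hpos
    simp only [aux_current M a u₀ C ha haM hC gtil x hx _ _ hS hgd]
    have n1 := h1.ne'
    have n2 := h2.ne'
    have n3 := h3.ne'
    have n4 := hSp.ne'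
    have e1 : rho2 a x = x 1 ^ 2 + a ^ 2 - a ^ 2 * Real.sin (x 2) ^ 2 := by
      unfold rho2; rw [Real.cos_sq']; ring
    have e3 : x 1 ^ 2 + a ^ 2 = rho2 a x + a ^ 2 * Real.sin (x 2) ^ 2 := by linarith
    rw [aux_F, e3]
    generalize Real.sqrt (gtil (x 2) ^ 2 - C ^ 2) = S at *
    generalize gtil (x 2) = G at *
    generalize deriv gtil (x 2) = G' at *
    fin_cases μ <;> simp [Fin.sum_univ_four]
    field_simp
    ring
  · intro x hx
    have h := aux_Fsq M a u₀ C ha haM hC gtil x hx (hgC _ hx.2)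
    refine ⟨h, fun hu => ?_⟩
    obtain ⟨h1, h2, h3⟩ := aux_pos M a ha haM x hx
    rw [h]
    positivity
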